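/- arXiv:1406.7658 — 4 statements merged into one kernel-verified Lean document; each statement's English description precedes it below -/
import Mathlib

section
/- (Kraft's inequality) For every prefix-free set S of binary strings, the sum over all s in S of 2^{-|s|}, taken in the extended nonnegative reals, is at most 1. -/
open scoped ENNReal

def PrefixFree (S : Set (List Bool)) : Prop :=
  ∀ s ∈ S, ∀ t ∈ S, s <+: t → s = t

theorem PrefixFree.mono {S T : Set (List Bool)} (hT : PrefixFree T) (h : S ⊆ T) :
    PrefixFree S :=
  fun s hs t ht hst => hT s (h hs) t (h ht) hst

theorem PrefixFree.eq_singleton_nil {S : Set (List Bool)} (hS : PrefixFree S) (h : [] ∈ S) :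
    S = {[]} :=
  Set.eq_singleton_iff_unique_mem.2 ⟨h, fun t ht => (hS [] h t ht t.nil_prefix).symm⟩

theorem PrefixFree.uniquelyDecodable {S : Set (List Bool)} (hS : PrefixFree S) (h : [] ∉ S) :
    InformationTheory.UniquelyDecodable S := by
  intro L₁
  induction L₁ with
  | nil =>
    rintro (_ | ⟨b, L₂⟩) _ h₂ he
    · rfl
    · have hb : b = [] := by simp_all
      exact absurd (hb ▸ h₂ b List.mem_cons_self) h
  | cons a L₁ ih =>
    rintro (_ | ⟨b, L₂⟩) h₁ h₂ he
    · have ha : a = [] := by simp_all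
      exact absurd (ha ▸ h₁ a List.mem_cons_self) h
    · have ha := h₁ a List.mem_cons_self
      have hb := h₂ b List.mem_cons_self
      rw [List.flatten_cons, List.flatten_cons] at he
      have hab : a = b := by
        rcases List.prefix_or_prefix_of_prefix (List.prefix_append a L₁.flatten)
          (he ▸ List.prefix_append b L₂.flatten) with hp | hp
        · exact hS a ha b hb hp
        · exact (hS b hb a ha hp).symm
      subst hab
      rw [ih L₂ (fun w hw => h₁ w (List.mem_cons_of_mem _ hw))
        (fun w hw => h₂ w (List.mem_cons_of_mem _ hw)) (List.append_cancel_left he)]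

theorem PrefixFree.sum_le_one {T : Finset (List Bool)} (hT : PrefixFree (T : Set (List Bool))) :
    ∑ w ∈ T, (2 : ℝ≥0∞)⁻¹ ^ w.length ≤ 1 := by
  by_cases h : [] ∈ (T : Set (List Bool))
  · have hs : T = {[]} := by exact_mod_cast hT.eq_singleton_nil h
    simp [hs]
  · have key := InformationTheory.kraft_mcmillan_inequality (hT.uniquelyDecodable h)
    have hterm (w : List Bool) :
        (2 : ℝ≥0∞)⁻¹ ^ w.length = ENNReal.ofReal ((1 / Fintype.card Bool : ℝ) ^ w.length) := by
      rw [ENNReal.ofReal_pow (by positivity), Fintype.card_bool, one_div,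
        ENNReal.ofReal_inv_of_pos (by norm_num)]
      simp
    simp_rw [hterm]
    rw [← ENNReal.ofReal_sum_of_nonneg fun _ _ => by positivity]
    exact ENNReal.ofReal_le_one.2 key

theorem kraft_inequality (S : Set (List Bool)) (hS : PrefixFree S) :
    ∑' s : S, (2 : ℝ≥0∞)⁻¹ ^ (s : List Bool).length ≤ 1 := by
  rw [ENNReal.tsum_eq_iSup_sum]
  refine iSup_le fun F => ?_
  have hF : PrefixFree (F.map (Function.Embedding.subtype (· ∈ S)) : Set (List Bool)) :=
    hS.mono fun w hw => by
      obtain ⟨s, -, rfl⟩ := Finset.mem_map.1 (Finset.mem_coe.1 hw)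
      exact s.2
  simpa using hF.sum_le_one
end

section
/- Let ℓ be a natural number and a a real number with 0 ≤ a and a + 2^{-ℓ} ≤ 1. Then there exists a binary string z of length ℓ + 2 such that Γ_z is contained in the half-open interval [a, a + 2^{-ℓ}). -/
open scoped ENNReal

noncomputable def strVal (z : List Bool) : ℝ :=
  ∑ i ∈ Finset.range z.length, if z.getD i false then (2 : ℝ)⁻¹ ^ (i + 1) else 0

noncomputable def Gamma (z : List Bool) : Set ℝ :=
  Set.Ico (strVal z) (strVal z + (2 : ℝ)⁻¹ ^ z.length)

theorem strVal_cons (b : Bool) (z : List Bool) :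
    strVal (b :: z) = (if b then (2 : ℝ)⁻¹ else 0) + 2⁻¹ * strVal z := by
  unfold strVal
  rw [List.length_cons, Finset.sum_range_succ', add_comm, Finset.mul_sum]
  congr 1
  · simp
  · refine Finset.sum_congr rfl fun i _ => ?_
    rw [List.getD_cons_succ, mul_ite, mul_zero, pow_succ' _ (i + 1)]

theorem exists_strVal_eq (n k : ℕ) (hk : k < 2 ^ n) :
    ∃ z : List Bool, z.length = n ∧ strVal z = k * (2 : ℝ)⁻¹ ^ n := by
  induction n generalizing k with
  | zero =>
    obtain rfl : k = 0 := by simpa using hk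
    exact ⟨[], rfl, by simp [strVal]⟩
  | succ n ih =>
    by_cases h : k < 2 ^ n
    · obtain ⟨z, hz, hv⟩ := ih k h
      refine ⟨false :: z, by simp [hz], ?_⟩
      rw [strVal_cons, hv]
      simp
      ring
    · obtain ⟨j, rfl⟩ := Nat.exists_eq_add_of_le (not_lt.mp h)
      obtain ⟨z, hz, hv⟩ := ih j (by rw [pow_succ] at hk; omega)
      refine ⟨true :: z, by simp [hz], ?_⟩
      have hp : (2 : ℝ) ^ n * 2⁻¹ ^ n = 1 := by rw [← mul_pow]; norm_num
      rw [strVal_cons, hv, if_pos rfl, pow_succ]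
      push_cast
      linear_combination -(2 : ℝ)⁻¹ * hp

theorem dyadic_in_interval (ℓ : ℕ) (a : ℝ) (h0 : 0 ≤ a)
    (h1 : a + (2 : ℝ)⁻¹ ^ ℓ ≤ 1) :
    ∃ z : List Bool, z.length = ℓ + 2 ∧
      Gamma z ⊆ Set.Ico a (a + (2 : ℝ)⁻¹ ^ ℓ) := by
  have hp : (2 : ℝ) ^ (ℓ + 2) * 2⁻¹ ^ (ℓ + 2) = 1 := by rw [← mul_pow]; norm_num
  have hq : (2 : ℝ)⁻¹ ^ ℓ = 4 * 2⁻¹ ^ (ℓ + 2) := by rw [pow_add]; ring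
  have hP : (0 : ℝ) < 2 ^ (ℓ + 2) := by positivity
  have hQ : (0 : ℝ) < 2⁻¹ ^ (ℓ + 2) := by positivity
  rw [hq] at h1 ⊢
  generalize hm : ℓ + 2 = m at *
  have hle := Nat.le_ceil (a * 2 ^ m)
  have hlt := Nat.ceil_lt_add_one (mul_nonneg h0 hP.le)
  obtain ⟨z, hz, hv⟩ := exists_strVal_eq m ⌈a * 2 ^ m⌉₊ (by
    have : (⌈a * 2 ^ m⌉₊ : ℝ) < 2 ^ m := by nlinarith
    exact_mod_cast this)
  refine ⟨z, hz, ?_⟩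
  have hle' := mul_le_mul_of_nonneg_right hle hQ.le
  have hlt' := mul_lt_mul_of_pos_right hlt hQ
  rw [add_mul, mul_assoc, hp] at hlt'
  rw [mul_assoc, hp] at hle'
  rw [Gamma, hz, hv]
  exact Set.Ico_subset_Ico (by linarith) (by linarith)
end

section
/- (Analogue of the Coding Theorem, Proposition 4.2, without time bounds) Let f : List Bool → ℕ be a computable function satisfying ∑_x 2^{-f(x)} ≤ 1, where the sum is over all binary strings x and is taken in the extended nonnegative reals. Then there exists a partial computable prefix machine M′ such that K_{M′}(x) = f(x) + 2 for every binary string x. -/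
open scoped ENNReal

noncomputable def Kcomplexity (U : List Bool →. List Bool) (x : List Bool) : ℕ∞ :=
  sInf {n : ℕ∞ | ∃ p : List Bool, x ∈ U p ∧ (p.length : ℕ∞) = n}

/-! ### Binary strings as dyadic intervals -/

/-- The natural number with binary expansion `p`, most significant bit first. -/
def binaryValue (p : List Bool) : ℕ :=
  p.foldl (fun n b => 2 * n + b.toNat) 0

theorem binaryValue_concat (p : List Bool) (b : Bool) :
    binaryValue (p ++ [b]) = 2 * binaryValue p + b.toNat := by
  simp [binaryValue]

theorem binaryValue_append_bounds (p r : List Bool) :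
    binaryValue p * 2 ^ r.length ≤ binaryValue (p ++ r) ∧
      binaryValue (p ++ r) + 1 ≤ (binaryValue p + 1) * 2 ^ r.length := by
  induction r using List.reverseRecOn with
  | nil => simp
  | append_singleton r b ih =>
    rw [← List.append_assoc, binaryValue_concat, List.length_append, List.length_singleton,
      pow_succ]
    have hb := Bool.toNat_le b
    constructor <;> nlinarith [ih.1, ih.2]

theorem exists_binaryValue_eq (l k : ℕ) (hk : k < 2 ^ l) :
    ∃ p : List Bool, p.length = l ∧ binaryValue p = k := by
  induction l generalizing k with
  | zero => exact ⟨[], rfl, by simp at hk; simp [binaryValue, hk]⟩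
  | succ l ih =>
    obtain ⟨p, hp, hv⟩ := ih (k / 2) (by rw [pow_succ] at hk; omega)
    refine ⟨p ++ [decide (k % 2 = 1)], by simp [hp], ?_⟩
    rw [binaryValue_concat, hv]
    rcases Nat.mod_two_eq_zero_or_one k with h | h <;> simp [h] <;> omega

theorem computable_binaryValue : Computable binaryValue := by
  have hbit : Primrec Bool.toNat := Primrec.dom_finite _
  have hstep : Primrec₂ fun (_ : List Bool) (q : ℕ × Bool) => 2 * q.1 + q.2.toNat :=
    Primrec.nat_add.comp
      (Primrec.nat_mul.comp (Primrec.const 2) (Primrec.fst.comp Primrec.snd))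
      (hbit.comp (Primrec.snd.comp Primrec.snd))
  exact (Primrec.list_foldl Primrec.id (Primrec.const 0) hstep).to_comp

/-- The left endpoint of the dyadic interval of `p`. -/
noncomputable def dyadicLeft (p : List Bool) : ℝ :=
  binaryValue p / 2 ^ p.length

/-- The right endpoint of the dyadic interval of `p`. -/
noncomputable def dyadicRight (p : List Bool) : ℝ :=
  (binaryValue p + 1) / 2 ^ p.length

theorem dyadicLeft_lt_dyadicRight (p : List Bool) : dyadicLeft p < dyadicRight p := by
  unfold dyadicLeft dyadicRight
  gcongr
  linarith

theorem dyadicLeft_mono {p q : List Bool} (h : p <+: q) :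
    dyadicLeft p ≤ dyadicLeft q := by
  obtain ⟨r, rfl⟩ := h
  unfold dyadicLeft
  rw [div_le_div_iff₀ (by positivity) (by positivity), List.length_append, pow_add]
  have h : (binaryValue p * 2 ^ r.length : ℝ) ≤ binaryValue (p ++ r) := by
    exact_mod_cast (binaryValue_append_bounds p r).1
  nlinarith [mul_le_mul_of_nonneg_right h (by positivity : (0 : ℝ) ≤ 2 ^ p.length)]

theorem dyadicRight_anti {p q : List Bool} (h : p <+: q) :
    dyadicRight q ≤ dyadicRight p := by
  obtain ⟨r, rfl⟩ := h
  unfold dyadicRight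
  rw [div_le_div_iff₀ (by positivity) (by positivity), List.length_append, pow_add]
  have h : (binaryValue (p ++ r) + 1 : ℝ) ≤ (binaryValue p + 1) * 2 ^ r.length := by
    exact_mod_cast (binaryValue_append_bounds p r).2
  nlinarith [mul_le_mul_of_nonneg_right h (by positivity : (0 : ℝ) ≤ 2 ^ p.length)]

/-! ### The Shannon–Fano code of a sequence of lengths -/

/-- The sum of `2⁻¹ ^ (g i + 1)` over `i < n`. -/
noncomputable def halfWeightSum (g : ℕ → ℕ) (n : ℕ) : ℝ :=
  ∑ i ∈ Finset.range n, (2 : ℝ)⁻¹ ^ (g i + 1)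

/-- One step of the summation on numerator-exponent pairs: adds `2⁻¹ ^ (m + 1)`. -/
def dyadicStep (m : ℕ) (s : ℕ × ℕ) : ℕ × ℕ :=
  (s.1 * 2 ^ (m + 1) + 2 ^ s.2, s.2 + (m + 1))

/-- A numerator and a binary exponent representing the dyadic rational `halfWeightSum g n`. -/
def dyadicSum (g : ℕ → ℕ) (n : ℕ) : ℕ × ℕ :=
  n.rec (0, 0) fun i s => dyadicStep (g i) s

/-- The value of the code word, of length `g n + 2`, assigned to `n`. -/
def codeValue (g : ℕ → ℕ) (n : ℕ) : ℕ :=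
  (dyadicSum g n).1 * 2 ^ (g n + 2) / 2 ^ (dyadicSum g n).2 + 1

/-- `p` is the code word assigned to `n`. -/
def IsCode (g : ℕ → ℕ) (n : ℕ) (p : List Bool) : Prop :=
  p.length = g n + 2 ∧ binaryValue p = codeValue g n

theorem primrec_two_pow : Primrec fun n : ℕ => 2 ^ n :=
  Primrec.of_eq
    (Primrec.nat_rec₁ 1 (Primrec.nat_mul.comp (Primrec.const 2) Primrec.snd).to₂)
    fun n => by
      induction n with
      | zero => rfl
      | succ n ih => rw [pow_succ, mul_comm, ← ih]

theorem primrec_dyadicStep : Primrec₂ dyadicStep := by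
  have hn : Primrec fun q : ℕ × (ℕ × ℕ) => q.1 + 1 := Primrec.succ.comp Primrec.fst
  have ha : Primrec fun q : ℕ × (ℕ × ℕ) => q.2.1 := Primrec.fst.comp Primrec.snd
  have he : Primrec fun q : ℕ × (ℕ × ℕ) => q.2.2 := Primrec.snd.comp Primrec.snd
  exact (Primrec.nat_add.comp (Primrec.nat_mul.comp ha (primrec_two_pow.comp hn))
    (primrec_two_pow.comp he)).pair (Primrec.nat_add.comp he hn)

theorem computable_dyadicSum {g : ℕ → ℕ} (hg : Computable g) : Computable (dyadicSum g) := by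
  have hstep : Computable₂ fun (_ : ℕ) (q : ℕ × (ℕ × ℕ)) => dyadicStep (g q.1) q.2 :=
    primrec_dyadicStep.to_comp.comp (hg.comp (Computable.fst.comp Computable.snd))
      (Computable.snd.comp Computable.snd)
  exact Computable.nat_rec Computable.id (Computable.const (0, 0)) hstep

theorem computable_codeValue {g : ℕ → ℕ} (hg : Computable g) : Computable (codeValue g) := by
  have h : Primrec fun q : ℕ × (ℕ × ℕ) => q.2.1 * 2 ^ (q.1 + 2) / 2 ^ q.2.2 + 1 :=
    Primrec.succ.comp (Primrec.nat_div.comp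
      (Primrec.nat_mul.comp (Primrec.fst.comp Primrec.snd)
        (primrec_two_pow.comp (Primrec.nat_add.comp Primrec.fst (Primrec.const 2))))
      (primrec_two_pow.comp (Primrec.snd.comp Primrec.snd)))
  exact h.to_comp.comp (hg.pair (computable_dyadicSum hg))

theorem halfWeightSum_succ (g : ℕ → ℕ) (n : ℕ) :
    halfWeightSum g (n + 1) = halfWeightSum g n + (2 : ℝ)⁻¹ ^ (g n + 1) :=
  Finset.sum_range_succ _ _

theorem halfWeightSum_mono (g : ℕ → ℕ) : Monotone (halfWeightSum g) :=
  monotone_nat_of_le_succ fun n => by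
    rw [halfWeightSum_succ]
    exact le_add_of_nonneg_right (by positivity)

theorem dyadicSum_eq (g : ℕ → ℕ) (n : ℕ) :
    ((dyadicSum g n).1 : ℝ) / 2 ^ (dyadicSum g n).2 = halfWeightSum g n := by
  induction n with
  | zero => simp [dyadicSum, halfWeightSum]
  | succ n ih =>
    have h : dyadicSum g (n + 1) = ((dyadicSum g n).1 * 2 ^ (g n + 1) + 2 ^ (dyadicSum g n).2,
      (dyadicSum g n).2 + (g n + 1)) := rfl
    rw [halfWeightSum_succ, ← ih, h, inv_pow]
    push_cast
    rw [pow_add _ (dyadicSum g n).2]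
    field_simp

theorem codeValue_eq_floor (g : ℕ → ℕ) (n : ℕ) :
    codeValue g n = ⌊halfWeightSum g n * 2 ^ (g n + 2)⌋₊ + 1 := by
  rw [codeValue, ← dyadicSum_eq, div_mul_eq_mul_div]
  congr 1
  rw [← Nat.floor_div_eq_div (K := ℝ)]
  push_cast
  rfl

theorem IsCode.lt_dyadicLeft {g : ℕ → ℕ} {n : ℕ} {p : List Bool} (h : IsCode g n p) :
    halfWeightSum g n < dyadicLeft p := by
  rw [dyadicLeft, h.1, h.2, lt_div_iff₀ (by positivity), codeValue_eq_floor]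
  push_cast
  exact Nat.lt_floor_add_one _

theorem codeValue_succ_le (g : ℕ → ℕ) (n : ℕ) :
    (codeValue g n + 1 : ℝ) ≤ halfWeightSum g (n + 1) * 2 ^ (g n + 2) := by
  have h0 : 0 ≤ halfWeightSum g n := Finset.sum_nonneg fun _ _ => by positivity
  have hfloor := Nat.floor_le (mul_nonneg h0 (by positivity : (0 : ℝ) ≤ 2 ^ (g n + 2)))
  have htwo : (2 : ℝ)⁻¹ ^ (g n + 1) * 2 ^ (g n + 2) = 2 := by
    rw [pow_succ (2 : ℝ) (g n + 1), inv_pow]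
    field_simp
  rw [codeValue_eq_floor, halfWeightSum_succ, add_mul, htwo]
  push_cast
  linarith

theorem IsCode.dyadicRight_le {g : ℕ → ℕ} {n : ℕ} {p : List Bool} (h : IsCode g n p) :
    dyadicRight p ≤ halfWeightSum g (n + 1) := by
  rw [dyadicRight, h.1, h.2, div_le_iff₀ (by positivity)]
  exact codeValue_succ_le g n

theorem IsCode.dyadicRight_lt_dyadicLeft {g : ℕ → ℕ} {i j : ℕ} {p q : List Bool}
    (hp : IsCode g i p) (hq : IsCode g j q) (hij : i < j) : dyadicRight p < dyadicLeft q :=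
  (hp.dyadicRight_le.trans (halfWeightSum_mono g hij)).trans_lt hq.lt_dyadicLeft

theorem IsCode.index_unique {g : ℕ → ℕ} {i j : ℕ} {p q : List Bool}
    (hp : IsCode g i p) (hq : IsCode g j q) (hpq : p <+: q) : i = j := by
  have hleft := dyadicLeft_mono hpq
  have hright := dyadicRight_anti hpq
  have hltp := dyadicLeft_lt_dyadicRight p
  have hltq := dyadicLeft_lt_dyadicRight q
  rcases lt_trichotomy i j with h | h | h
  · linarith [hp.dyadicRight_lt_dyadicLeft hq h]
  · exact h
  · linarith [hq.dyadicRight_lt_dyadicLeft hp h]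

theorem exists_isCode {g : ℕ → ℕ} {n : ℕ} (h : halfWeightSum g (n + 1) ≤ 1) :
    ∃ p, IsCode g n p := by
  refine exists_binaryValue_eq _ _ ?_
  have hle := (codeValue_succ_le g n).trans
    (mul_le_of_le_one_left (by positivity : (0 : ℝ) ≤ 2 ^ (g n + 2)) h)
  exact_mod_cast hle

/-! ### The decoding machine -/

/-- The machine that, on input `p`, looks for the index with code word `p` and outputs the string
encoded by that index, if any. -/
def decoder (g : ℕ → ℕ) (p : List Bool) : Part (List Bool) :=
  (Nat.rfind fun n => Part.some (decide (p.length = g n + 2) &&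
    decide (binaryValue p = codeValue g n))).bind
    fun n => (Encodable.decode₂ (List Bool) n : Option (List Bool))

theorem partrec_decoder {g : ℕ → ℕ} (hg : Computable g) : Partrec (decoder g) := by
  have heq : Computable₂ fun a b : ℕ => decide (a = b) := Primrec.eq.decide.to_comp
  have hlen : Computable fun q : List Bool × ℕ => decide (q.1.length = g q.2 + 2) :=
    heq.comp (Computable.list_length.comp Computable.fst)
      ((Computable.succ.comp Computable.succ).comp (hg.comp Computable.snd))
  have hval : Computable fun q : List Bool × ℕ => decide (binaryValue q.1 = codeValue g q.2) :=
    heq.comp (computable_binaryValue.comp Computable.fst)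
      ((computable_codeValue hg).comp Computable.snd)
  have htest : Computable₂ fun (p : List Bool) (n : ℕ) =>
      decide (p.length = g n + 2) && decide (binaryValue p = codeValue g n) :=
    Primrec.and.to_comp.comp hlen hval
  exact (Partrec.rfind htest.partrec₂).bind
    (Primrec.decode₂.to_comp.comp Computable.snd).ofOption

theorem mem_decoder_iff {g : ℕ → ℕ} {p x : List Bool} :
    x ∈ decoder g p ↔ IsCode g (Encodable.encode x) p := by
  simp only [decoder, Part.mem_bind_iff, Part.mem_ofOption, Encodable.mem_decode₂]
  constructor
  · rintro ⟨n, hn, rfl⟩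
    simpa [IsCode] using Nat.rfind_spec hn
  · intro h
    refine ⟨Encodable.encode x, Nat.mem_rfind.2 ⟨by simpa [IsCode] using h, ?_⟩, rfl⟩
    intro m hm
    have : ¬ IsCode g m p := fun hmp => hm.ne (hmp.index_unique h List.prefix_rfl)
    simpa [IsCode] using this

theorem prefixFree_dom_decoder (g : ℕ → ℕ) : PrefixFree (PFun.Dom (decoder g)) := by
  intro p hp q hq hpq
  obtain ⟨x, hx⟩ := Part.dom_iff_mem.1 hp
  obtain ⟨y, hy⟩ := Part.dom_iff_mem.1 hq
  have hx := mem_decoder_iff.1 hx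
  have hy := mem_decoder_iff.1 hy
  have h := hx.index_unique hy hpq
  exact hpq.eq_of_length (by rw [hx.1, hy.1, h])

/-! ### Lengths indexed by natural numbers -/

/-- The function `f` transported along the encoding of strings as natural numbers; numbers that
encode no string get values whose total weight is at most one. -/
def indexedLength (f : List Bool → ℕ) (n : ℕ) : ℕ :=
  Option.casesOn (Encodable.decode₂ (List Bool) n) (n + 1) f

theorem indexedLength_encode (f : List Bool → ℕ) (x : List Bool) :
    indexedLength f (Encodable.encode x) = f x := by
  simp [indexedLength, Encodable.decode₂_encode]

theorem computable_indexedLength {f : List Bool → ℕ} (hf : Computable f) :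
    Computable (indexedLength f) :=
  Computable.option_casesOn Primrec.decode₂.to_comp Computable.succ (hf.comp Computable.snd).to₂

theorem tsum_indexedLength_le {f : List Bool → ℕ}
    (hsum : ∑' x : List Bool, (2 : ℝ≥0∞)⁻¹ ^ f x ≤ 1) :
    ∑' n, (2 : ℝ≥0∞)⁻¹ ^ indexedLength f n ≤ 2 := by
  set w : ℕ → ℝ≥0∞ := fun n =>
    (Encodable.decode₂ (List Bool) n).elim 0 fun x => (2 : ℝ≥0∞)⁻¹ ^ f x with hw
  have hle (n : ℕ) : (2 : ℝ≥0∞)⁻¹ ^ indexedLength f n ≤ 2⁻¹ ^ (n + 1) + w n := by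
    cases h : Encodable.decode₂ (List Bool) n <;> simp [indexedLength, hw, h]
  have hsupp : Function.support w ⊆ Set.range (Encodable.encode (α := List Bool)) := by
    intro n hn
    cases h : Encodable.decode₂ (List Bool) n with
    | none => simp [hw, h] at hn
    | some x => exact ⟨x, Encodable.mem_decode₂.1 h⟩
  have hwsum : ∑' n, w n ≤ 1 := by
    rw [← Encodable.encode_injective.tsum_eq hsupp]
    simpa [hw, Encodable.decode₂_encode] using hsum
  calc ∑' n, (2 : ℝ≥0∞)⁻¹ ^ indexedLength f n
      ≤ ∑' n, ((2 : ℝ≥0∞)⁻¹ ^ (n + 1) + w n) := ENNReal.tsum_le_tsum hle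
    _ = ∑' n, (2 : ℝ≥0∞)⁻¹ ^ (n + 1) + ∑' n, w n := ENNReal.tsum_add
    _ ≤ 1 + 1 := by
      refine add_le_add (le_of_eq ?_) hwsum
      rw [ENNReal.tsum_geometric_add_one, ENNReal.one_sub_inv_two, inv_inv]
      exact ENNReal.inv_mul_cancel two_ne_zero ENNReal.ofNat_ne_top
    _ = 2 := one_add_one_eq_two

theorem halfWeightSum_le_one {g : ℕ → ℕ} (hg : ∑' n, (2 : ℝ≥0∞)⁻¹ ^ g n ≤ 2) (n : ℕ) :
    halfWeightSum g n ≤ 1 := by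
  have hfin : ∑ i ∈ Finset.range n, (2 : ℝ≥0∞)⁻¹ ^ g i ≤ 2 := (ENNReal.sum_le_tsum _).trans hg
  have hreal : ∑ i ∈ Finset.range n, (2 : ℝ)⁻¹ ^ g i ≤ 2 := by
    have h := ENNReal.toReal_mono ENNReal.ofNat_ne_top hfin
    rw [ENNReal.toReal_sum fun i _ => ENNReal.pow_ne_top (by simp)] at h
    simpa using h
  simp only [halfWeightSum, pow_succ, ← Finset.sum_mul]
  linarith

theorem coding_theorem (f : List Bool → ℕ) (hf : Computable f)
    (hsum : ∑' x : List Bool, (2 : ℝ≥0∞)⁻¹ ^ f x ≤ 1) :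
    ∃ M' : List Bool →. List Bool, Partrec M' ∧ PrefixFree M'.Dom ∧
      ∀ x : List Bool, Kcomplexity M' x = ((f x + 2 : ℕ) : ℕ∞) := by
  refine ⟨decoder (indexedLength f), partrec_decoder (computable_indexedLength hf),
    prefixFree_dom_decoder _, fun x => ?_⟩
  have hlen {p : List Bool} (hp : IsCode (indexedLength f) (Encodable.encode x) p) :
      p.length = f x + 2 := by
    rw [hp.1, indexedLength_encode]
  obtain ⟨p, hp⟩ := exists_isCode (halfWeightSum_le_one (tsum_indexedLength_le hsum)
    (Encodable.encode x + 1))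
  apply le_antisymm
  · exact sInf_le ⟨p, mem_decoder_iff.2 hp, by rw [hlen hp]⟩
  · refine le_sInf ?_
    rintro _ ⟨q, hq, rfl⟩
    rw [hlen (mem_decoder_iff.1 hq)]
end

section
/- (Claim 4.6 / Claim 1 without time bounds) Let U₀ be a partial computable prefix machine and let F : List Bool → ℕ be a computable function satisfying ∑_x 2^{-F(x)} ≤ 1, the sum over all binary strings x taken in the extended nonnegative reals. Define H : List Bool → ℕ∞ by H(x) = min(K_{U₀}(x) + 5, F(x) + 3), with minimum and addition in ℕ∞. Then there exists a partial computable prefix machine U such that K_U(x) = H(x) for every binary string x. -/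
open scoped ENNReal

open Encodable

namespace KraftCode

/-- The natural number with binary expansion `q`, most significant bit first. -/
def binaryValue (q : List Bool) : ℕ :=
  q.foldl (fun v b => 2 * v + encode b) 0

theorem primrec_binaryValue : Primrec binaryValue :=
  Primrec.list_foldl Primrec.id (Primrec.const 0)
    (Primrec.nat_add.comp
      (Primrec.nat_mul.comp (Primrec.const 2) (Primrec.fst.comp Primrec.snd))
      (Primrec.encode.comp (Primrec.snd.comp Primrec.snd))).to₂

theorem encode_bool_le_one (b : Bool) : encode b ≤ 1 := by cases b <;> decide

theorem foldl_bits_bounds (r : List Bool) (v : ℕ) :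
    v * 2 ^ r.length ≤ r.foldl (fun v b => 2 * v + encode b) v ∧
      r.foldl (fun v b => 2 * v + encode b) v < (v + 1) * 2 ^ r.length := by
  induction r generalizing v with
  | nil => simp
  | cons b r ih =>
    obtain ⟨h₁, h₂⟩ := ih (2 * v + encode b)
    have hb := encode_bool_le_one b
    have hp : 0 < 2 ^ r.length := by positivity
    simp only [List.foldl_cons, List.length_cons, pow_succ]
    constructor <;> nlinarith

theorem binaryValue_append_bounds (q r : List Bool) :
    binaryValue q * 2 ^ r.length ≤ binaryValue (q ++ r) ∧
      binaryValue (q ++ r) < (binaryValue q + 1) * 2 ^ r.length := by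
  simpa only [binaryValue, List.foldl_append] using foldl_bits_bounds r (binaryValue q)

theorem exists_binaryValue_eq (l k : ℕ) (hk : k < 2 ^ l) :
    ∃ q : List Bool, q.length = l ∧ binaryValue q = k := by
  induction l generalizing k with
  | zero => exact ⟨[], rfl, by simp at hk; simp [binaryValue, hk]⟩
  | succ l ih =>
    obtain ⟨q, hl, hv⟩ := ih (k / 2) (by rw [pow_succ] at hk; omega)
    refine ⟨q ++ [k.bodd], by simp [hl], ?_⟩
    have hb : (encode k.bodd : ℕ) = k % 2 := by
      rw [Nat.mod_two_of_bodd]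
      cases k.bodd <;> rfl
    rw [binaryValue, List.foldl_append, ← binaryValue, hv]
    simp only [List.foldl_cons, List.foldl_nil, hb]
    omega

variable {α : Type*} [Primcodable α] (F : α → ℕ)

/-- A pair `(a, e)` with `a / 2 ^ e` the sum of `2 ^ (-F x)` over all `x` with `encode x < n`. -/
def partialWeight (n : ℕ) : ℕ × ℕ :=
  Nat.rec (0, 0)
    (fun k s => Option.casesOn (decode₂ α k) s
      fun x => (s.1 * 2 ^ F x + 2 ^ s.2, s.2 + F x)) n

/-- The index among the dyadic intervals of length `2 ^ (-F x - 1)` of the one assigned to `x`. -/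
def codeIndex (x : α) : ℕ :=
  (partialWeight F (encode x)).1 * 2 ^ (F x + 1) / 2 ^ (partialWeight F (encode x)).2 + 1

/-- The symbol with code number `n`, provided that `q` is its code word. -/
def decodeAt (q : List Bool) (n : ℕ) : Option α :=
  (decode₂ α n).bind fun x =>
    cond (decide (q.length = F x + 1) && decide (binaryValue q = codeIndex F x)) (some x) none

/-- The machine mapping the code word of each `x` to `x`. -/
def decoder : List Bool →. α := fun q =>
  Nat.rfindOpt (decodeAt F q)

theorem primrec_two_pow : Primrec fun n : ℕ => 2 ^ n :=
  (Primrec.nat_rec₁ 1 (Primrec.nat_mul.comp Primrec.snd (Primrec.const 2)).to₂).of_eq fun n => by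
    induction n with
    | zero => rfl
    | succ n ih => simp only [ih, pow_succ]

variable {F}

theorem computable_partialWeight (hF : Computable F) : Computable (partialWeight F) := by
  have h2 := primrec_two_pow.to_comp
  have hs : Computable fun p : (ℕ × ℕ × (ℕ × ℕ)) × α => p.1.2.2 :=
    Computable.snd.comp (Computable.snd.comp Computable.fst)
  have hx : Computable fun p : (ℕ × ℕ × (ℕ × ℕ)) × α => F p.2 := hF.comp Computable.snd
  have hstep : Computable₂ fun (p : ℕ × ℕ × (ℕ × ℕ)) (x : α) =>
      (p.2.2.1 * 2 ^ F x + 2 ^ p.2.2.2, p.2.2.2 + F x) :=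
    Computable.pair
      (Primrec.nat_add.to_comp.comp
        (Primrec.nat_mul.to_comp.comp (Computable.fst.comp hs) (h2.comp hx))
        (h2.comp (Computable.snd.comp hs)))
      (Primrec.nat_add.to_comp.comp (Computable.snd.comp hs) hx)
  have hdec : Computable fun p : ℕ × ℕ × (ℕ × ℕ) => decode₂ α p.2.1 :=
    Primrec.decode₂.to_comp.comp (Computable.fst.comp Computable.snd)
  exact Computable.nat_rec Computable.id (Computable.const (0, 0))
    (Computable.option_casesOn hdec (Computable.snd.comp Computable.snd) hstep).to₂

theorem computable_codeIndex (hF : Computable F) : Computable (codeIndex F) := by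
  have h2 := primrec_two_pow.to_comp
  have hw : Computable fun x : α => partialWeight F (encode x) :=
    (computable_partialWeight hF).comp Computable.encode
  have hs : Computable fun x : α => 2 ^ (F x + 1) := h2.comp (Computable.succ.comp hF)
  exact Computable.succ.comp (Primrec.nat_div.to_comp.comp
    (Primrec.nat_mul.to_comp.comp (Computable.fst.comp hw) hs)
    (h2.comp (Computable.snd.comp hw)))

theorem computable_decodeAt (hF : Computable F) : Computable₂ (decodeAt F) := by
  have hq : Computable fun p : (List Bool × ℕ) × α => p.1.1 :=
    Computable.fst.comp Computable.fst
  have hlen : Computable fun p : (List Bool × ℕ) × α => decide (p.1.1.length = F p.2 + 1) :=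
    Primrec.eq.decide.to_comp.comp (Primrec.list_length.to_comp.comp hq)
      (Computable.succ.comp (hF.comp Computable.snd))
  have hval : Computable fun p : (List Bool × ℕ) × α =>
      decide (binaryValue p.1.1 = codeIndex F p.2) :=
    Primrec.eq.decide.to_comp.comp (primrec_binaryValue.to_comp.comp hq)
      ((computable_codeIndex hF).comp Computable.snd)
  have hstep : Computable₂ fun (p : List Bool × ℕ) (x : α) =>
      cond (decide (p.1.length = F x + 1) && decide (binaryValue p.1 = codeIndex F x))
        (some x) none :=
    Computable.cond (Primrec.and.to_comp.comp hlen hval)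
      (Computable.option_some.comp Computable.snd) (Computable.const none)
  exact Computable.option_bind (Primrec.decode₂.to_comp.comp Computable.snd) hstep

theorem partrec_decoder (hF : Computable F) : Partrec (decoder F) :=
  Partrec.rfindOpt (computable_decodeAt hF)

theorem mem_decodeAt {q : List Bool} {n : ℕ} {x : α} :
    x ∈ decodeAt F q n ↔
      encode x = n ∧ q.length = F x + 1 ∧ binaryValue q = codeIndex F x := by
  simp only [decodeAt, Option.mem_def, Option.bind_eq_some_iff, decode₂_eq_some]
  constructor
  · rintro ⟨y, hy, h⟩
    cases hc : (decide (q.length = F y + 1) && decide (binaryValue q = codeIndex F y)) <;>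
      simp_all
  · rintro ⟨h₁, h₂, h₃⟩
    exact ⟨x, h₁, by simp [h₂, h₃]⟩

theorem of_mem_decoder {q : List Bool} {x : α} (h : x ∈ decoder F q) :
    q.length = F x + 1 ∧ binaryValue q = codeIndex F x :=
  let ⟨_, hn⟩ := Nat.rfindOpt_spec h
  (mem_decodeAt.1 hn).2

variable (F)

/-- The real number represented by `partialWeight F n`. -/
noncomputable def weight (n : ℕ) : ℝ :=
  (partialWeight F n).1 / 2 ^ (partialWeight F n).2

theorem weight_succ_of_none {n : ℕ} (h : decode₂ α n = none) :
    weight F (n + 1) = weight F n := by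
  simp only [weight, partialWeight, h]

theorem weight_succ_of_some {n : ℕ} {x : α} (h : decode₂ α n = some x) :
    weight F (n + 1) = weight F n + (2 ^ F x)⁻¹ := by
  have : partialWeight F (n + 1) = ((partialWeight F n).1 * 2 ^ F x + 2 ^ (partialWeight F n).2,
      (partialWeight F n).2 + F x) := by
    simp only [partialWeight, h]
  simp only [weight, this]
  push_cast
  rw [pow_add]
  field_simp

theorem weight_mono : Monotone (weight F) := by
  refine monotone_nat_of_le_succ fun n => ?_
  cases h : decode₂ α n with
  | none => exact (weight_succ_of_none F h).ge
  | some x =>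
    rw [weight_succ_of_some F h]
    exact le_add_of_nonneg_right (by positivity)

theorem weight_eq_sum (n : ℕ) :
    ∃ s : Finset α, (∀ x ∈ s, encode x < n) ∧ weight F n = ∑ x ∈ s, ((2 : ℝ) ^ F x)⁻¹ := by
  classical
  induction n with
  | zero => exact ⟨∅, by simp, by simp [weight, partialWeight]⟩
  | succ n ih =>
    obtain ⟨s, hs, hw⟩ := ih
    cases h : decode₂ α n with
    | none =>
      exact ⟨s, fun x hx => (hs x hx).trans n.lt_succ_self, (weight_succ_of_none F h).trans hw⟩
    | some x =>
      have hx : encode x = n := decode₂_eq_some.1 h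
      refine ⟨insert x s, ?_, ?_⟩
      · simp only [Finset.mem_insert]
        rintro y (rfl | hy)
        · omega
        · exact (hs y hy).trans n.lt_succ_self
      · rw [weight_succ_of_some F h, hw, Finset.sum_insert fun h => (hs x h).ne hx, add_comm]

variable {F}

theorem weight_le_one (hsum : ∑' x, (2 : ℝ≥0∞)⁻¹ ^ F x ≤ 1) (n : ℕ) : weight F n ≤ 1 := by
  obtain ⟨s, -, hs⟩ := weight_eq_sum F n
  have h := (ENNReal.sum_le_tsum s).trans hsum
  have h' := ENNReal.toReal_mono ENNReal.one_ne_top h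
  rw [ENNReal.toReal_sum fun x _ => by simp] at h'
  simpa [hs] using h'

/-- The interval assigned to `x` lies in `[weight F (encode x), weight F (encode x + 1)]`. -/
theorem codeIndex_bounds (x : α) :
    weight F (encode x) * 2 ^ (F x + 1) < codeIndex F x ∧
      (codeIndex F x : ℝ) + 1 ≤ weight F (encode x + 1) * 2 ^ (F x + 1) := by
  rw [weight_succ_of_some F (encodek₂ x)]
  have hw : weight F (encode x) * 2 ^ (F x + 1) =
      (((partialWeight F (encode x)).1 * 2 ^ (F x + 1) : ℕ) : ℝ) /
        ((2 ^ (partialWeight F (encode x)).2 : ℕ) : ℝ) := by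
    push_cast
    rw [weight, div_mul_eq_mul_div]
  have hl : ((2 : ℝ) ^ F x)⁻¹ * 2 ^ (F x + 1) = 2 := by
    rw [pow_succ]
    field_simp
  rw [add_mul, hl, hw]
  simp only [codeIndex]
  set a := (partialWeight F (encode x)).1 * 2 ^ (F x + 1)
  set d := 2 ^ (partialWeight F (encode x)).2
  have hd : (0 : ℝ) < d := by positivity
  have h₁ : (a / d : ℕ) ≤ (a : ℝ) / d := Nat.cast_div_le
  have h₂ : (a : ℝ) / d < (a / d : ℕ) + 1 := by
    rw [div_lt_iff₀ hd]
    exact_mod_cast Nat.lt_mul_of_div_lt (Nat.lt_succ_self (a / d)) (by positivity)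
  push_cast at h₁ h₂ ⊢
  constructor <;> linarith

theorem codeIndex_lt (hsum : ∑' x, (2 : ℝ≥0∞)⁻¹ ^ F x ≤ 1) (x : α) :
    codeIndex F x < 2 ^ (F x + 1) := by
  have h := (codeIndex_bounds (F := F) x).2
  have hw : weight F (encode x + 1) * 2 ^ (F x + 1) ≤ 1 * 2 ^ (F x + 1) := by
    gcongr
    exact weight_le_one hsum _
  have : (codeIndex F x : ℝ) < 2 ^ (F x + 1) := by linarith
  exact_mod_cast this

theorem encode_eq_of_code_words {q t : List Bool} {x y : α} (hqt : q <+: t)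
    (hq : q.length = F x + 1 ∧ binaryValue q = codeIndex F x)
    (ht : t.length = F y + 1 ∧ binaryValue t = codeIndex F y) : encode x = encode y := by
  obtain ⟨r, rfl⟩ := hqt
  obtain ⟨h₁, h₂⟩ := binaryValue_append_bounds q r
  rw [hq.2, ht.2] at h₁ h₂
  replace h₁ : (codeIndex F x : ℝ) * 2 ^ r.length ≤ codeIndex F y := by exact_mod_cast h₁
  replace h₂ : (codeIndex F y : ℝ) + 1 ≤ (codeIndex F x + 1) * 2 ^ r.length := by exact_mod_cast h₂
  have hl : (2 : ℝ) ^ (F y + 1) = 2 ^ (F x + 1) * 2 ^ r.length := by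
    rw [← ht.1, ← hq.1, List.length_append, pow_add]
  obtain ⟨hx₁, hx₂⟩ := codeIndex_bounds (F := F) x
  obtain ⟨hy₁, hy₂⟩ := codeIndex_bounds (F := F) y
  rw [hl, ← mul_assoc] at hy₁ hy₂
  have hr : (0 : ℝ) < 2 ^ r.length := by positivity
  rcases lt_trichotomy (encode x) (encode y) with h | h | h
  · have hw : weight F (encode x + 1) * 2 ^ (F x + 1) * 2 ^ r.length ≤
        weight F (encode y) * 2 ^ (F x + 1) * 2 ^ r.length := by
      gcongr
      exact weight_mono F h
    have := mul_le_mul_of_nonneg_right hx₂ hr.le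
    linarith
  · exact h
  · have hw : weight F (encode y + 1) * 2 ^ (F x + 1) * 2 ^ r.length ≤
        weight F (encode x) * 2 ^ (F x + 1) * 2 ^ r.length := by
      gcongr
      exact weight_mono F h
    have := mul_lt_mul_of_pos_right hx₁ hr
    linarith

theorem prefixFree_decoder : PrefixFree (decoder F).Dom := by
  intro s hs t ht hst
  have hx := of_mem_decoder (Part.get_mem hs)
  have hy := of_mem_decoder (Part.get_mem ht)
  have h := encode_injective (encode_eq_of_code_words hst hx hy)
  exact hst.eq_of_length (by rw [hx.1, hy.1, h])

theorem exists_mem_decoder (hsum : ∑' x, (2 : ℝ≥0∞)⁻¹ ^ F x ≤ 1) (x : α) :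
    ∃ q, x ∈ decoder F q := by
  obtain ⟨q, hl, hv⟩ := exists_binaryValue_eq _ _ (codeIndex_lt hsum x)
  have hd : (decoder F q).Dom := Nat.rfindOpt_dom.2 ⟨_, x, mem_decodeAt.2 ⟨rfl, hl, hv⟩⟩
  have hy := of_mem_decoder (Part.get_mem hd)
  have h := encode_injective (encode_eq_of_code_words List.prefix_rfl ⟨hl, hv⟩ hy)
  exact ⟨q, h ▸ Part.get_mem hd⟩

end KraftCode

/-- Run `V` on inputs starting with `true` and `U` on the others, ignoring a header of
`j` (respectively `k`) bits. -/
def mergeMachines (j k : ℕ) (V U : List Bool →. List Bool) : List Bool →. List Bool := fun q =>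
  cond q.headI
    (cond (decide (j ≤ q.length)) (V (q.drop j)) Part.none)
    (cond (decide (k ≤ q.length)) (U (q.drop k)) Part.none)

section mergeMachines

variable {j k : ℕ} {V U : List Bool →. List Bool}

theorem partrec_mergeMachines (hV : Partrec V) (hU : Partrec U) :
    Partrec (mergeMachines j k V U) := by
  have aux (i : ℕ) {W : List Bool →. List Bool} (hW : Partrec W) :
      Partrec fun q : List Bool => cond (decide (i ≤ q.length)) (W (q.drop i)) Part.none :=
    Partrec.cond
      (Primrec.nat_le.decide.comp (Primrec.const i) Primrec.list_length).to_comp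
      (hW.comp (Primrec.list_drop.comp (Primrec.const i) Primrec.id).to_comp) Partrec.none
  exact Partrec.cond Primrec.list_headI.to_comp (aux j hV) (aux k hU)

theorem mem_mergeMachines {q x : List Bool} :
    x ∈ mergeMachines j k V U q ↔
      (q.headI = true ∧ j ≤ q.length ∧ x ∈ V (q.drop j)) ∨
        (q.headI = false ∧ k ≤ q.length ∧ x ∈ U (q.drop k)) := by
  cases h : q.headI <;> by_cases hj : j ≤ q.length <;> by_cases hk : k ≤ q.length <;>
    simp [mergeMachines, h, hj, hk]

theorem prefixFree_mergeMachines (hj : 0 < j) (hk : 0 < k) (hV : PrefixFree V.Dom)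
    (hU : PrefixFree U.Dom) : PrefixFree (mergeMachines j k V U).Dom := by
  intro s hs t ht hst
  obtain ⟨x, hx⟩ := (PFun.mem_dom _ _).1 hs
  obtain ⟨y, hy⟩ := (PFun.mem_dom _ _).1 ht
  have aux {W : List Bool →. List Bool} (hW : PrefixFree W.Dom) {i : ℕ} (hs : i ≤ s.length)
      (ht : i ≤ t.length) (hx : x ∈ W (s.drop i)) (hy : y ∈ W (t.drop i)) : s = t := by
    have h := congrArg List.length (hW _ ((PFun.mem_dom _ _).2 ⟨x, hx⟩) _
      ((PFun.mem_dom _ _).2 ⟨y, hy⟩) (hst.drop i))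
    simp only [List.length_drop] at h
    exact hst.eq_of_length (by omega)
  have hhead (h : 0 < s.length) : s.headI = t.headI := by
    obtain ⟨r, rfl⟩ := hst
    cases s with
    | nil => simp at h
    | cons b s => rfl
  rcases mem_mergeMachines.1 hx with ⟨hs₁, hs₂, hs₃⟩ | ⟨hs₁, hs₂, hs₃⟩ <;>
    rcases mem_mergeMachines.1 hy with ⟨ht₁, ht₂, ht₃⟩ | ⟨ht₁, ht₂, ht₃⟩
  · exact aux hV hs₂ ht₂ hs₃ ht₃
  · simp [hhead (hj.trans_le hs₂), ht₁] at hs₁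
  · simp [hhead (hk.trans_le hs₂), ht₁] at hs₁
  · exact aux hU hs₂ ht₂ hs₃ ht₃

theorem Kcomplexity_le {x p : List Bool} (h : x ∈ U p) : Kcomplexity U x ≤ p.length :=
  sInf_le ⟨p, h, rfl⟩

theorem le_Kcomplexity {x : List Bool} {n : ℕ∞} (h : ∀ p, x ∈ U p → n ≤ p.length) :
    n ≤ Kcomplexity U x :=
  le_sInf (by rintro _ ⟨p, hp, rfl⟩; exact h p hp)

theorem exists_length_eq_Kcomplexity {x : List Bool} (h : Kcomplexity U x ≠ ⊤) :
    ∃ p, x ∈ U p ∧ (p.length : ℕ∞) = Kcomplexity U x := by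
  refine csInf_mem (s := {n : ℕ∞ | ∃ p : List Bool, x ∈ U p ∧ (p.length : ℕ∞) = n}) ?_
  by_contra he
  exact h (by rw [Kcomplexity, Set.not_nonempty_iff_eq_empty.1 he, sInf_empty])

theorem Kcomplexity_mergeMachines (hj : 0 < j) (hk : 0 < k) (x : List Bool) :
    Kcomplexity (mergeMachines j k V U) x = min (Kcomplexity U x + k) (Kcomplexity V x + j) := by
  apply le_antisymm
  · have aux {W : List Bool →. List Bool} {i : ℕ} {b : Bool} (hi : 0 < i)
        (h : ∀ q, q.headI = b → i ≤ q.length → x ∈ W (q.drop i) → x ∈ mergeMachines j k V U q) :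
        Kcomplexity (mergeMachines j k V U) x ≤ Kcomplexity W x + i := by
      by_cases ht : Kcomplexity W x = ⊤
      · simp [ht]
      obtain ⟨p, hp, hl⟩ := exists_length_eq_Kcomplexity ht
      obtain ⟨i, rfl⟩ := Nat.exists_eq_succ_of_ne_zero hi.ne'
      have hq := Kcomplexity_le (h (List.replicate (i + 1) b ++ p) rfl (by simp)
        (by simpa [List.drop_append] using hp))
      rw [← hl]
      refine hq.trans (le_of_eq ?_)
      rw [List.length_append, List.length_replicate, Nat.cast_add, add_comm]
    refine le_min (aux hk (b := false) fun q h₁ h₂ h₃ => ?_)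
      (aux hj (b := true) fun q h₁ h₂ h₃ => ?_)
    · exact mem_mergeMachines.2 (Or.inr ⟨h₁, h₂, h₃⟩)
    · exact mem_mergeMachines.2 (Or.inl ⟨h₁, h₂, h₃⟩)
  · refine le_Kcomplexity fun q hq => ?_
    have aux {W : List Bool →. List Bool} {i : ℕ} (hi : i ≤ q.length) (h : x ∈ W (q.drop i)) :
        Kcomplexity W x + i ≤ q.length := by
      refine (add_le_add_left (Kcomplexity_le h) _).trans (le_of_eq ?_)
      rw [List.length_drop, ← Nat.cast_add, Nat.sub_add_cancel hi]
    rcases mem_mergeMachines.1 hq with ⟨-, hl, h⟩ | ⟨-, hl, h⟩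
    · exact (min_le_right _ _).trans (aux hl h)
    · exact (min_le_left _ _).trans (aux hl h)

end mergeMachines

theorem KraftCode.Kcomplexity_decoder {F : List Bool → ℕ}
    (hsum : ∑' x, (2 : ℝ≥0∞)⁻¹ ^ F x ≤ 1) (x : List Bool) :
    Kcomplexity (decoder F) x = F x + 1 := by
  have hl {q : List Bool} (h : x ∈ decoder F q) : (q.length : ℕ∞) = F x + 1 := by
    exact_mod_cast (of_mem_decoder h).1
  obtain ⟨q, hq⟩ := exists_mem_decoder hsum x
  exact le_antisymm ((Kcomplexity_le hq).trans_eq (hl hq)) (le_Kcomplexity fun p hp => (hl hp).ge)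

theorem min_complexity_is_complexity (U₀ : List Bool →. List Bool)
    (hU₀ : Partrec U₀) (hU₀pf : PrefixFree U₀.Dom)
    (F : List Bool → ℕ) (hF : Computable F)
    (hsum : ∑' x : List Bool, (2 : ℝ≥0∞)⁻¹ ^ F x ≤ 1) :
    ∃ U : List Bool →. List Bool, Partrec U ∧ PrefixFree U.Dom ∧
      ∀ x : List Bool,
        Kcomplexity U x = min (Kcomplexity U₀ x + 5) ((F x : ℕ∞) + 3) := by
  refine ⟨mergeMachines 2 5 (KraftCode.decoder F) U₀,
    partrec_mergeMachines (KraftCode.partrec_decoder hF) hU₀,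
    prefixFree_mergeMachines (by norm_num) (by norm_num) KraftCode.prefixFree_decoder hU₀pf,
    fun x => ?_⟩
  rw [Kcomplexity_mergeMachines (by norm_num) (by norm_num), KraftCode.Kcomplexity_decoder hsum,
    add_assoc]
  norm_num
end
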